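/- For every k ≥ 1, χ(|𝕊⟩^{⊗2k}) ≤ 2^k. In particular the per-copy asymptotic stabilizer-rank exponent of the Strange state satisfies γ_𝕊 ≤ log₃(2)/2: for every k, log₃ χ(|𝕊⟩^{⊗2k})/(2k) ≤ log₃(2)/2. -/

import Mathlib

open Complex
open scoped BigOperators

noncomputable section

/-- An `m`-qutrit state is a vector of amplitudes indexed by `Fin m → ZMod 3`. -/
abbrev QS (m : ℕ) := (Fin m → ZMod 3) → ℂ

/-- The primitive cube root of unity `ω = exp(2πi/3)`. -/
def ω : ℂ := Complex.exp (2 * Real.pi * Complex.I / 3)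

/-- `ω` raised to an exponent in `ZMod 3`. -/
def ωp (a : ZMod 3) : ℂ := ω ^ a.val

/-- A polynomial `Q : 𝔽₃^k → 𝔽₃` of degree at most 2. -/
def IsDeg2 {k : ℕ} (Q : (Fin k → ZMod 3) → ZMod 3) : Prop :=
  ∃ (A : Fin k → Fin k → ZMod 3) (b : Fin k → ZMod 3) (c : ZMod 3),
    ∀ y, Q y = (∑ i, ∑ j, A i j * y i * y j) + (∑ i, b i * y i) + c

/-- `σ` is a canonical `m`-qutrit stabilizer state:
`σ = 3^{-k/2} ∑_{y ∈ 𝔽₃^k} ω^{Q(y)} |x₀ + W y⟩` with `W` injective linear and `deg Q ≤ 2`. -/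
def IsStab {m : ℕ} (σ : QS m) : Prop :=
  ∃ k : ℕ, k ≤ m ∧
    ∃ (x₀ : Fin m → ZMod 3)
      (W : (Fin k → ZMod 3) →ₗ[ZMod 3] (Fin m → ZMod 3))
      (Q : (Fin k → ZMod 3) → ZMod 3),
      Function.Injective W ∧ IsDeg2 Q ∧
      σ = fun x => ((Real.sqrt (3 ^ k) : ℝ) : ℂ)⁻¹ *
        ∑ y : Fin k → ZMod 3, if x = x₀ + W y then ωp (Q y) else 0

/-- The stabilizer rank: the least `r` such that `ψ` is a ℂ-linear combination of `r`
canonical stabilizer states. -/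
def stabRank {m : ℕ} (ψ : QS m) : ℕ :=
  sInf {r : ℕ | ∃ (c : Fin r → ℂ) (σ : Fin r → QS m),
    (∀ i, IsStab (σ i)) ∧ ψ = ∑ i, c i • σ i}

/-- The `m`-fold tensor power of a single-qutrit state. -/
def tpow (ψ : ZMod 3 → ℂ) (m : ℕ) : QS m := fun x => ∏ i, ψ (x i)

/-- The Strange state `|𝕊⟩ = (|1⟩ - |2⟩)/√2`. -/
def Strange : ZMod 3 → ℂ := fun j =>
  ((if j = 1 then 1 else 0) - (if j = 2 then 1 else 0)) / (Real.sqrt 2 : ℂ)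

theorem omega_isPrimitiveRoot : IsPrimitiveRoot ω 3 := by
  simpa [ω] using Complex.isPrimitiveRoot_exp 3 (by norm_num)

theorem omegaPow_add (a b : ZMod 3) : ωp (a + b) = ωp a * ωp b := by
  unfold ωp
  rw [← pow_add, ZMod.val_add, ← pow_eq_pow_mod _ omega_isPrimitiveRoot.pow_eq_one]

theorem omegaPow_sum {ι : Type*} (s : Finset ι) (f : ι → ZMod 3) :
    ωp (∑ i ∈ s, f i) = ∏ i ∈ s, ωp (f i) := by
  classical
  induction s using Finset.induction_on with
  | empty => simp [ωp]
  | insert a s ha ih => rw [Finset.sum_insert ha, Finset.prod_insert ha, omegaPow_add, ih]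

/-- The sign `±1 ∈ 𝔽₃` selected by a Boolean. -/
def boolSign (t : Bool) : ZMod 3 := if t then 1 else -1

/-- The coefficients of the two stabilizer states in the decomposition of `|𝕊⟩ ⊗ |𝕊⟩`. -/
def pairCoeff (t : Bool) : ℂ := (if t then 1 else -1) * (2 * (ω - ω ^ 2))⁻¹

/-- `|𝕊⟩ ⊗ |𝕊⟩` is a combination of the two states with phases `ω^{ab}` and `ω^{-ab}`. -/
theorem strange_mul_strange (a b : ZMod 3) :
    Strange a * Strange b = ∑ t : Bool, pairCoeff t * ωp (boolSign t * a * b) := by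
  have hω : ω - ω ^ 2 ≠ 0 := by
    have h0 : ω ≠ 0 := omega_isPrimitiveRoot.ne_zero (by norm_num)
    have h1 : ω ≠ 1 := omega_isPrimitiveRoot.ne_one (by norm_num)
    have : ω - ω ^ 2 = ω * (1 - ω) := by ring
    rw [this]
    exact mul_ne_zero h0 (sub_ne_zero.mpr h1.symm)
  have h2 : ((Real.sqrt 2 : ℝ) : ℂ) * ((Real.sqrt 2 : ℝ) : ℂ) = 2 := by
    rw [← Complex.ofReal_mul, Real.mul_self_sqrt (by norm_num)]
    norm_num
  have key : (((if a = 1 then 1 else 0) - (if a = 2 then 1 else 0)) *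
      ((if b = 1 then 1 else 0) - (if b = 2 then 1 else 0)) : ℂ) * (ω - ω ^ 2) =
      ωp (a * b) - ωp (-a * b) := by
    have h10 : (1 : ZMod 3) ≠ 0 := by decide
    have h20 : (2 : ZMod 3) ≠ 0 := by decide
    have h12 : (1 : ZMod 3) ≠ 2 := by decide
    have v0 : (0 : ZMod 3).val = 0 := rfl
    have v1 : (1 : ZMod 3).val = 1 := rfl
    have v2 : (2 : ZMod 3).val = 2 := rfl
    have n1 : (-1 : ZMod 3) = 2 := rfl
    have n2 : (-2 : ZMod 3) = 1 := rfl
    have m22 : (2 * 2 : ZMod 3) = 1 := rfl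
    have cases3 : ∀ c : ZMod 3, c = 0 ∨ c = 1 ∨ c = 2 := by decide
    rcases cases3 a with rfl | rfl | rfl <;> rcases cases3 b with rfl | rfl | rfl <;>
      simp [ωp, h12, h10.symm, h20.symm, h12.symm, v0, v1, v2, n1, n2, m22]
  simp only [Strange, Fintype.sum_bool, pairCoeff, boolSign]
  rw [div_mul_div_comm, h2]
  simp only [if_true, Bool.false_eq_true, if_false, one_mul, neg_mul]
  rw [neg_mul] at key
  generalize ω - ω ^ 2 = d at hω key ⊢
  field_simp
  linear_combination key

/-- A state with full support and quadratic phases is a stabilizer state. -/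
theorem isStab_quadratic_phase {m : ℕ} {Q : (Fin m → ZMod 3) → ZMod 3} (hQ : IsDeg2 Q) :
    IsStab fun x => ((Real.sqrt (3 ^ m) : ℝ) : ℂ)⁻¹ * ωp (Q x) :=
  ⟨m, le_rfl, 0, LinearMap.id, Q, Function.injective_id, hQ, by simp⟩

theorem isDeg2_sum_mul_mul {m : ℕ} {ι : Type*} [Fintype ι] (s : ι → ZMod 3) (a b : ι → Fin m) :
    IsDeg2 fun y => ∑ j, s j * y (a j) * y (b j) := by
  classical
  refine ⟨fun i i' => ∑ j, if a j = i ∧ b j = i' then s j else 0, 0, 0, fun y => ?_⟩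
  simp only [Pi.zero_apply, zero_mul, Finset.sum_const_zero, add_zero, Finset.sum_mul]
  rw [Finset.sum_congr rfl fun i _ => Finset.sum_comm, Finset.sum_comm]
  simp [ite_and, ite_mul]

theorem stabRank_le_card {m : ℕ} {ψ : QS m} {ι : Type*} [Fintype ι] (c : ι → ℂ) (σ : ι → QS m)
    (hσ : ∀ i, IsStab (σ i)) (hψ : ψ = ∑ i, c i • σ i) : stabRank ψ ≤ Fintype.card ι := by
  let e := (Fintype.equivFin ι).symm
  refine Nat.sInf_le ⟨c ∘ e, σ ∘ e, fun i => hσ _, ?_⟩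
  rw [hψ]
  exact (Equiv.sum_comp e fun i => c i • σ i).symm

theorem stabRank_tpow_strange_le (k : ℕ) : stabRank (tpow Strange (2 * k)) ≤ 2 ^ k := by
  let e : Fin 2 × Fin k ≃ Fin (2 * k) := finProdFinEquiv
  let Q (p : Fin k → Bool) (x : Fin (2 * k) → ZMod 3) : ZMod 3 :=
    ∑ j, boolSign (p j) * x (e (0, j)) * x (e (1, j))
  let N : ℂ := ((Real.sqrt (3 ^ (2 * k)) : ℝ) : ℂ)
  have hN : N ≠ 0 := Complex.ofReal_ne_zero.mpr (by positivity)
  have h := stabRank_le_card (ψ := tpow Strange (2 * k))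
    (fun p : Fin k → Bool => N * ∏ j, pairCoeff (p j)) (fun p x => N⁻¹ * ωp (Q p x))
    (fun p => isStab_quadratic_phase (isDeg2_sum_mul_mul _ _ _)) ?_
  · simpa using h
  · funext x
    have hprod : tpow Strange (2 * k) x =
        ∏ j, Strange (x (e (0, j))) * Strange (x (e (1, j))) := by
      rw [tpow, ← Equiv.prod_comp e, Fintype.prod_prod_type, Fin.prod_univ_two,
        Finset.prod_mul_distrib]
    rw [hprod]
    simp only [strange_mul_strange, Finset.sum_apply, Pi.smul_apply, smul_eq_mul]
    rw [Fintype.prod_sum]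
    refine Finset.sum_congr rfl fun p _ => ?_
    rw [omegaPow_sum, Finset.prod_mul_distrib]
    field_simp

/-- `χ(|𝕊⟩^{⊗2k}) ≤ 2^k` for every `k ≥ 1`, hence
`log₃ χ(|𝕊⟩^{⊗2k}) / (2k) ≤ log₃(2)/2`. -/
theorem strange_exponent_bound :
    ∀ k : ℕ, 1 ≤ k →
      stabRank (tpow Strange (2 * k)) ≤ 2 ^ k ∧
      Real.logb 3 (stabRank (tpow Strange (2 * k)) : ℝ) / (2 * k : ℝ) ≤
        Real.logb 3 2 / 2 := by
  intro k hk
  have h := stabRank_tpow_strange_le k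
  refine ⟨h, ?_⟩
  have hk' : (0 : ℝ) < k := by exact_mod_cast hk
  have hlog : Real.logb 3 (stabRank (tpow Strange (2 * k)) : ℝ) ≤ k * Real.logb 3 2 := by
    rcases Nat.eq_zero_or_pos (stabRank (tpow Strange (2 * k))) with h0 | h0
    · rw [h0, Nat.cast_zero, Real.logb_zero]
      exact mul_nonneg hk'.le (Real.logb_nonneg (by norm_num) (by norm_num))
    · rw [← Real.logb_pow]
      exact Real.logb_le_logb_of_le (by norm_num) (by exact_mod_cast h0) (by exact_mod_cast h)
  rw [div_le_div_iff₀ (by positivity) (by norm_num)]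
  linarith
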